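/- (Infinite-run correspondence lemma) Let σ be a system of equations in normal form and 𝒜 the k-BRA constructed from σ. Then for every infinite data word w, position i, assignment θ, and variable V ∈ Var: w,i,θ ⊨_{lfp(F_{σ,w})} V if and only if there exist an accepting state q_F ∈ F, positions i < i₁ < i₂ < ⋯, and assignments θ₁, θ₂, … such that (σ(V),θ,w[i..]) ⊢*_𝒜 (q_F,θ₁,w[i₁..]) ⊢*_𝒜 (q_F,θ₂,w[i₂..]) ⊢*_𝒜 ⋯. -/

import Mathlib

namespace MuCal

/-- Basic formulas Φ_k over atomic propositions `At` and `k` registers. -/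
inductive Phi (At : Type) (k : ℕ) : Type
  | tt : Phi At k
  | ff : Phi At k
  | pos : At → Phi At k
  | npos : At → Phi At k
  | up : Fin k → Phi At k
  | nup : Fin k → Phi At k
  | conj : Phi At k → Phi At k → Phi At k

/-- LTL↓dω formulas over variables `Var`. -/
inductive Fml (At : Type) (k : ℕ) (Var : Type) : Type
  | var : Var → Fml At k Var
  | or : Fml At k Var → Fml At k Var → Fml At k Var
  | dX : Finset (Fin k) → Fml At k Var → Phi At k → Fml At k Var
  | tt : Fml At k Var

variable {At D Q Var : Type} {k : ℕ}

/-- θ[R←d] : update the registers in `R` to hold `d`. -/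
def updA (θ : Fin k → D) (R : Finset (Fin k)) (d : D) : Fin k → D :=
  fun r => if r ∈ R then d else θ r

/-- Satisfaction of basic formulas: w,i,θ ⊨ φ. -/
def phiSat (w : ℕ → Set At × D) (i : ℕ) (θ : Fin k → D) : Phi At k → Prop
  | Phi.tt => True
  | Phi.ff => False
  | Phi.pos p => p ∈ (w i).1
  | Phi.npos p => p ∉ (w i).1
  | Phi.up r => θ r = (w i).2
  | Phi.nup r => θ r ≠ (w i).2
  | Phi.conj φ₁ φ₂ => phiSat w i θ φ₁ ∧ phiSat w i θ φ₂

/-- Environments: each variable gets a set of 5-tuples (i,θ;j,θ′,x). -/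
abbrev Env (D : Type) (k : ℕ) (Var : Type) : Type :=
  Var → Set (ℕ × (Fin k → D) × ℕ × (Fin k → D) × Var)

/-- The augmented relation w,i,θ,j,θ′,x ⊨_u ψ. -/
def aSat (vtt : Var) (w : ℕ → Set At × D) (u : Env D k Var) :
    Fml At k Var → ℕ → (Fin k → D) → ℕ → (Fin k → D) → Var → Prop
  | Fml.var V, i, θ, j, θ', x => (i, θ, j, θ', x) ∈ u V
  | Fml.or ψ₁ ψ₂, i, θ, j, θ', x =>
      aSat vtt w u ψ₁ i θ j θ' x ∨ aSat vtt w u ψ₂ i θ j θ' x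
  | Fml.dX R ψ φ, i, θ, j, θ', x =>
      i < j ∧ phiSat w i θ φ ∧ aSat vtt w u ψ (i + 1) (updA θ R (w i).2) j θ' x
  | Fml.tt, _, θ, _, θ', x => θ = θ' ∧ x = vtt

/-- A system of equations: σ with a main variable, ω-variables, and V_tt. -/
structure EqSys (At : Type) (k : ℕ) (Var : Type) where
  σ : Var → Fml At k Var
  main : Var
  omega : Set Var
  vtt : Var

/-- Well-formedness conditions from Definition (system of equations):
V_tt ∈ Var_ω, σ(V_tt) = tt, and σ is injective on ω-variables. -/
def EqSys.WF (S : EqSys At k Var) : Prop :=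
  S.vtt ∈ S.omega ∧ S.σ S.vtt = Fml.tt ∧
    ∀ V ∈ S.omega, ∀ V' : Var, S.σ V = S.σ V' → V = V'

/-- The variable updating mapping F_{σ,w}. -/
def Fmap (S : EqSys At k Var) (w : ℕ → Set At × D) (u : Env D k Var) : Env D k Var :=
  fun V =>
    {t | aSat S.vtt w u (S.σ V) t.1 t.2.1 t.2.2.1 t.2.2.2.1 t.2.2.2.2} ∪
    {t | V ∈ S.omega ∧ ∃ (i : ℕ) (θ : Fin k → D), t = (i, θ, i, θ, V)}

/-- The least fixed point of F_{σ,w} (Knaster–Tarski form). -/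
def lfpEnv (S : EqSys At k Var) (w : ℕ → Set At × D) : Env D k Var :=
  sInf {u | Fmap S w u ≤ u}

/-- w,i,θ ⊨_u V : an infinite chain of dependence through u exists. -/
def satVar (S : EqSys At k Var) (w : ℕ → Set At × D) (u : Env D k Var)
    (i : ℕ) (θ : Fin k → D) (V : Var) : Prop :=
  ∃ (I : ℕ → ℕ) (Θ : ℕ → Fin k → D) (X : ℕ → Var),
    I 0 = i ∧ Θ 0 = θ ∧ X 0 = V ∧
    (∀ n, I n < I (n + 1)) ∧ (∀ n, X (n + 1) ∈ S.omega) ∧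
    (∀ n, (I n, Θ n, I (n + 1), Θ (n + 1), X (n + 1)) ∈ u (X n))

/-- w ⊨ σ : w,1,⊥^k ⊨_{lfp(F_{σ,w})} V_main. -/
def sats (S : EqSys At k Var) (dbot : D) (w : ℕ → Set At × D) : Prop :=
  satVar S w (lfpEnv S w) 1 (fun _ => dbot) S.main

/-- Normal form: every equation is V = V′ ∨ V″, V = ↓_R X V′ ∧ φ, or V = tt. -/
def InNormalForm (S : EqSys At k Var) : Prop :=
  ∀ V : Var,
    (∃ V₁ V₂ : Var, S.σ V = Fml.or (Fml.var V₁) (Fml.var V₂)) ∨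
    (∃ (R : Finset (Fin k)) (V₁ : Var) (φ : Phi At k), S.σ V = Fml.dX R (Fml.var V₁) φ) ∨
    S.σ V = Fml.tt

/-- `IsDisj ψ s` : ψ is an iterated disjunction of exactly the variables in `s`. -/
inductive IsDisj {At : Type} {k : ℕ} {Var : Type} : Fml At k Var → Set Var → Prop
  | var (V : Var) : IsDisj (Fml.var V) {V}
  | or {ψ₁ ψ₂ : Fml At k Var} {s₁ s₂ : Set Var} :
      IsDisj ψ₁ s₁ → IsDisj ψ₂ s₂ → IsDisj (Fml.or ψ₁ ψ₂) (s₁ ∪ s₂)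

/-- A Büchi register automaton with k registers; `none` as guard means ε. -/
structure BRA (At : Type) (k : ℕ) (Q : Type) where
  q0 : Q
  δ : Set (Q × Option (Phi At k) × Finset (Fin k) × Q)
  acc : Set Q

/-- One transition step on IDs (q,θ,i), where i is the current position. -/
inductive BStep (A : BRA At k Q) (w : ℕ → Set At × D) :
    Q × (Fin k → D) × ℕ → Q × (Fin k → D) × ℕ → Prop
  | rule {q q' : Q} {φ : Phi At k} {R : Finset (Fin k)} {θ : Fin k → D} {i : ℕ} :
      (q, some φ, R, q') ∈ A.δ → phiSat w i θ φ →
      BStep A w (q, θ, i) (q', updA θ R (w i).2, i + 1)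
  | eps {q q' : Q} {θ : Fin k → D} {i : ℕ} :
      (q, none, (∅ : Finset (Fin k)), q') ∈ A.δ →
      BStep A w (q, θ, i) (q', θ, i)

/-- ⊢* : reflexive-transitive closure of the step relation. -/
def BSteps (A : BRA At k Q) (w : ℕ → Set At × D) :
    Q × (Fin k → D) × ℕ → Q × (Fin k → D) × ℕ → Prop :=
  Relation.ReflTransGen (BStep A w)

/-- Büchi acceptance: some accepting state is visited at infinitely many,
strictly increasing positions, starting from (q₀, ⊥^k) at position 1. -/
def accepts (A : BRA At k Q) (dbot : D) (w : ℕ → Set At × D) : Prop :=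
  ∃ qF ∈ A.acc, ∃ (I : ℕ → ℕ) (Θ : ℕ → Fin k → D),
    1 ≤ I 0 ∧ (∀ n, I n < I (n + 1)) ∧
    BSteps A w (A.q0, fun _ => dbot, 1) (qF, Θ 0, I 0) ∧
    ∀ n, BSteps A w (qF, Θ n, I n) (qF, Θ (n + 1), I (n + 1))

def lang (A : BRA At k Q) (dbot : D) : Set (ℕ → Set At × D) :=
  {w | accepts A dbot w}

/-- The BRA constructed from a normal-form system σ (Theorem μ↓dω → BRA):
states are the formulas σ(V), initial state σ(V_t), accepting states σ(V_ω). -/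
def toBRA (S : EqSys At k Var) : BRA At k (Fml At k Var) where
  q0 := S.σ S.main
  δ :=
    {t | t = (Fml.tt, some Phi.tt, (∅ : Finset (Fin k)), Fml.tt)} ∪
    {t | ∃ V V₁ V₂ : Var, S.σ V = Fml.or (Fml.var V₁) (Fml.var V₂) ∧
          (t = (S.σ V, none, (∅ : Finset (Fin k)), S.σ V₁) ∨
           t = (S.σ V, none, (∅ : Finset (Fin k)), S.σ V₂))} ∪
    {t | ∃ (V : Var) (R : Finset (Fin k)) (V₁ : Var) (φ : Phi At k),
          S.σ V = Fml.dX R (Fml.var V₁) φ ∧ t = (S.σ V, some φ, R, S.σ V₁)}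
  acc := S.σ '' S.omega

/-- Variables of the system constructed from a BRA:
V_q for q ∈ Q, V_r for r ∈ δ, and V_tt. -/
abbrev RVar (A : BRA At k Q) : Type := Q ⊕ ({r // r ∈ A.δ} ⊕ Unit)

/-- The BRA 𝒜′ obtained by applying the μ↓dω-to-BRA construction (with m-ary
disjunction states) to the system σ constructed from 𝒜. -/
def roundBRA (A : BRA At k Q) (S : EqSys At k (RVar A)) :
    BRA At k (Fml At k (RVar A)) where
  q0 := S.σ (Sum.inl A.q0)
  δ :=
    {t | t = (Fml.tt, some Phi.tt, (∅ : Finset (Fin k)), Fml.tt)} ∪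
    {t | ∃ (q : Q) (r : {r // r ∈ A.δ}), r.val.1 = q ∧
          t = (S.σ (Sum.inl q), none, (∅ : Finset (Fin k)), S.σ (Sum.inr (Sum.inl r)))} ∪
    {t | ∃ r : {r // r ∈ A.δ},
          t = (S.σ (Sum.inr (Sum.inl r)), r.val.2.1, r.val.2.2.1,
               S.σ (Sum.inl r.val.2.2.2))}
  acc := (fun q : Q => S.σ (Sum.inl q)) '' A.acc ∪ {Fml.tt}

end MuCal

open MuCal

namespace MuCal

variable {At D Var : Type} {k : ℕ}

theorem aSat_mono (vtt : Var) (w : ℕ → Set At × D) {u v : Env D k Var} (huv : u ≤ v)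
    (ψ : Fml At k Var) {i : ℕ} {θ : Fin k → D} {j : ℕ} {θ' : Fin k → D} {x : Var}
    (h : aSat vtt w u ψ i θ j θ' x) : aSat vtt w v ψ i θ j θ' x := by
  induction ψ generalizing i θ with
  | var V => exact huv V h
  | or ψ₁ ψ₂ ih₁ ih₂ => exact Or.imp ih₁ ih₂ h
  | dX R ψ φ ih => exact ⟨h.1, h.2.1, ih h.2.2⟩
  | tt => exact h

theorem Fmap_mono (S : EqSys At k Var) (w : ℕ → Set At × D) : Monotone (Fmap S w) :=
  fun _ _ huv _ => Set.union_subset_union_left _ fun _ h => aSat_mono _ _ huv _ h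

theorem Fmap_lfpEnv (S : EqSys At k Var) (w : ℕ → Set At × D) :
    Fmap S w (lfpEnv S w) = lfpEnv S w :=
  OrderHom.map_lfp ⟨Fmap S w, Fmap_mono S w⟩

theorem lfpEnv_le (S : EqSys At k Var) (w : ℕ → Set At × D) {u : Env D k Var}
    (h : Fmap S w u ≤ u) : lfpEnv S w ≤ u :=
  sInf_le h

theorem mem_lfpEnv_iff (S : EqSys At k Var) (w : ℕ → Set At × D) {V x : Var} {i j : ℕ}
    {θ θ' : Fin k → D} :
    (i, θ, j, θ', x) ∈ lfpEnv S w V ↔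
      aSat S.vtt w (lfpEnv S w) (S.σ V) i θ j θ' x ∨
        V ∈ S.omega ∧ j = i ∧ θ' = θ ∧ x = V := by
  conv_lhs => rw [← Fmap_lfpEnv]
  constructor
  · rintro (h | ⟨hV, i', η, h⟩)
    · exact Or.inl h
    · simp only [Prod.mk.injEq] at h
      obtain ⟨rfl, rfl, rfl, rfl, rfl⟩ := h
      exact Or.inr ⟨hV, rfl, rfl, rfl⟩
  · rintro (h | ⟨hV, rfl, rfl, rfl⟩)
    · exact Or.inl h
    · exact Or.inr ⟨hV, _, _, rfl⟩

@[simp]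
theorem updA_empty (θ : Fin k → D) (d : D) : updA θ ∅ d = θ := by
  funext r
  simp [updA]

theorem BStep.position_le {Q : Type} {A : BRA At k Q} {w : ℕ → Set At × D}
    {a b : Q × (Fin k → D) × ℕ} (h : BStep A w a b) : a.2.2 ≤ b.2.2 := by
  cases h with
  | rule => exact Nat.le_succ _
  | eps => exact le_rfl

theorem BSteps.position_le {Q : Type} {A : BRA At k Q} {w : ℕ → Set At × D}
    {a b : Q × (Fin k → D) × ℕ} (h : BSteps A w a b) : a.2.2 ≤ b.2.2 := by
  induction h with
  | refl => exact le_rfl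
  | tail _ h ih => exact ih.trans h.position_le

theorem bsteps_tt (S : EqSys At k Var) (w : ℕ → Set At × D) (θ : Fin k → D) {i j : ℕ}
    (hij : i ≤ j) : BSteps (toBRA S) w (Fml.tt, θ, i) (Fml.tt, θ, j) := by
  induction j, hij using Nat.le_induction with
  | base => exact .refl
  | succ j _ ih =>
    refine ih.tail ?_
    have h : BStep (toBRA S) w (Fml.tt, θ, j) (Fml.tt, updA θ ∅ (w j).2, j + 1) :=
      .rule (φ := Phi.tt) (Or.inl (Or.inl rfl)) trivial
    rwa [updA_empty] at h

/-- A dependence in the least fixed point is realised by a finite run. -/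
theorem bsteps_of_mem_lfpEnv {S : EqSys At k Var} (hWF : S.WF) (hNF : InNormalForm S)
    {w : ℕ → Set At × D} {V x : Var} {i j : ℕ} {θ θ' : Fin k → D}
    (h : (i, θ, j, θ', x) ∈ lfpEnv S w V) (hij : i ≤ j) :
    BSteps (toBRA S) w (S.σ V, θ, i) (S.σ x, θ', j) := by
  let u : Env D k Var := fun V => {t | t.1 ≤ t.2.2.1 →
    BSteps (toBRA S) w (S.σ V, t.2.1, t.1) (S.σ t.2.2.2.2, t.2.2.2.1, t.2.2.1)}
  suffices hu : Fmap S w u ≤ u from lfpEnv_le S w hu V h hij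
  rintro V ⟨i, θ, j, θ', x⟩ (h | ⟨-, i', η, h⟩) hij
  · dsimp only at h hij ⊢
    obtain ⟨V₁, V₂, hV⟩ | ⟨R, V₁, φ, hV⟩ | hV := hNF V
    · rw [hV] at h
      obtain h | h := h
      · exact .head (.eps (Or.inl (Or.inr ⟨V, V₁, V₂, hV, Or.inl rfl⟩))) (h hij)
      · exact .head (.eps (Or.inl (Or.inr ⟨V, V₁, V₂, hV, Or.inr rfl⟩))) (h hij)
    · rw [hV] at h
      obtain ⟨hlt, hφ, h⟩ := h
      exact .head (.rule (Or.inr ⟨V, R, V₁, φ, hV, rfl⟩) hφ) (h hlt)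
    · rw [hV] at h ⊢
      obtain ⟨rfl, rfl⟩ : θ = θ' ∧ x = S.vtt := h
      rw [hWF.2.1]
      exact bsteps_tt S w θ hij
  · simp only [Prod.mk.injEq] at h
    obtain ⟨rfl, rfl, rfl, rfl, rfl⟩ := h
    exact .refl

/-- A finite run into an accepting state is a dependence in the least fixed point. -/
theorem mem_lfpEnv_of_bsteps {S : EqSys At k Var} (hWF : S.WF)
    {w : ℕ → Set At × D} {V x : Var} (hx : x ∈ S.omega) {i j : ℕ} {θ θ' : Fin k → D}
    (h : BSteps (toBRA S) w (S.σ V, θ, i) (S.σ x, θ', j)) :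
    (i, θ, j, θ', x) ∈ lfpEnv S w V := by
  suffices H : ∀ a, BSteps (toBRA S) w a (S.σ x, θ', j) → ∀ V, a.1 = S.σ V →
      (a.2.2, a.2.1, j, θ', x) ∈ lfpEnv S w V from H _ h V rfl
  intro a ha
  induction ha using Relation.ReflTransGen.head_induction_on with
  | refl =>
    intro V hV
    obtain rfl := hWF.2.2 x hx V hV
    exact (mem_lfpEnv_iff S w).2 (Or.inr ⟨hx, rfl, rfl, rfl⟩)
  | head hstep hrest ih =>
    intro V hV
    refine (mem_lfpEnv_iff S w).2 (Or.inl ?_)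
    rw [← hV]
    cases hstep with
    | rule hδ hφ =>
      obtain (hδ | ⟨V₀, V₁, V₂, h₀, hδ | hδ⟩) | ⟨V₀, R, V₁, φ, h₀, hδ⟩ := hδ <;>
        simp only [Set.mem_ofPred_eq, Prod.mk.injEq, Option.some.injEq, reduceCtorEq, false_and, and_false] at hδ
      · obtain ⟨rfl, rfl, rfl, rfl⟩ := hδ
        have := ih S.vtt hWF.2.1.symm
        rw [mem_lfpEnv_iff, hWF.2.1, updA_empty] at this
        obtain ⟨h₁, h₂⟩ | ⟨-, -, h₁, h₂⟩ := this
        · exact ⟨h₁, h₂⟩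
        · exact ⟨h₁.symm, h₂⟩
      · obtain ⟨rfl, rfl, rfl, rfl⟩ := hδ
        rw [h₀]
        exact ⟨BSteps.position_le hrest, hφ, ih V₁ rfl⟩
    | eps hδ =>
      obtain (hδ | ⟨V₀, V₁, V₂, h₀, hδ | hδ⟩) | ⟨V₀, R, V₁, φ, h₀, hδ⟩ := hδ <;>
        simp only [Set.mem_ofPred_eq, Prod.mk.injEq, reduceCtorEq, false_and, and_false, true_and] at hδ
      · obtain ⟨rfl, rfl⟩ := hδ
        rw [h₀]
        exact Or.inl (ih V₁ rfl)
      · obtain ⟨rfl, rfl⟩ := hδ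
        rw [h₀]
        exact Or.inr (ih V₂ rfl)

end MuCal

/-- Infinite-run correspondence lemma: w,i,θ ⊨_{lfp(F_{σ,w})} V iff
𝒜 has a run from (σ(V),θ,w[i..]) visiting some accepting state at infinitely many
strictly increasing positions i < i₁ < i₂ < ⋯. -/
theorem infinite_run_correspondence (At D : Type) [Finite At] [Countable D] [Infinite D]
    (k : ℕ) (Var : Type) [Finite Var]
    (S : EqSys At k Var) (hWF : S.WF) (hNF : InNormalForm S)
    (w : ℕ → Set At × D) (i : ℕ) (θ : Fin k → D) (V : Var) :
    satVar S w (lfpEnv S w) i θ V ↔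
      ∃ qF ∈ (toBRA S).acc, ∃ (I : ℕ → ℕ) (Θ : ℕ → Fin k → D),
        i < I 0 ∧ (∀ n, I n < I (n + 1)) ∧
        BSteps (toBRA S) w (S.σ V, θ, i) (qF, Θ 0, I 0) ∧
        ∀ n, BSteps (toBRA S) w (qF, Θ n, I n) (qF, Θ (n + 1), I (n + 1)) := by
  constructor
  · rintro ⟨I, Θ, X, rfl, rfl, rfl, hI, hX, hmem⟩
    have hI' : StrictMono I := strictMono_nat_of_lt_succ hI
    have hrun : ∀ {a b : ℕ}, a ≤ b →
        BSteps (toBRA S) w (S.σ (X a), Θ a, I a) (S.σ (X b), Θ b, I b) := by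
      intro a b hab
      induction b, hab using Nat.le_induction with
      | base => exact .refl
      | succ b _ ih => exact ih.trans (bsteps_of_mem_lfpEnv hWF hNF (hmem b) (hI b).le)
    obtain ⟨x, hx⟩ := Finite.exists_infinite_fiber fun n => X (n + 1)
    obtain ⟨f, hf, hfx⟩ := Filter.extraction_of_frequently_atTop
      (Nat.frequently_atTop_iff_infinite.2 (Set.infinite_coe_iff.1 hx))
    have hfx' : ∀ n, X (f n + 1) = x := hfx
    refine ⟨S.σ x, ⟨x, hfx' 0 ▸ hX _, rfl⟩, fun n => I (f n + 1), fun n => Θ (f n + 1),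
      hI' (Nat.succ_pos _), fun n => hI' (Nat.succ_lt_succ (hf n.lt_succ_self)), ?_, fun n => ?_⟩
    · have h := hrun (Nat.zero_le (f 0 + 1))
      rwa [hfx'] at h
    · have h := hrun (Nat.succ_le_succ (hf n.lt_succ_self).le)
      rwa [Nat.succ_eq_add_one, Nat.succ_eq_add_one, hfx', hfx'] at h
  · rintro ⟨_, ⟨x, hx, rfl⟩, I, Θ, h₀, hI, hrun₀, hrun⟩
    refine ⟨fun n => n.casesOn i I, fun n => n.casesOn θ Θ, fun n => n.casesOn V fun _ => x,
      rfl, rfl, rfl, ?_, fun _ => hx, ?_⟩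
    · rintro (_ | n)
      exacts [h₀, hI n]
    · rintro (_ | n)
      exacts [mem_lfpEnv_of_bsteps hWF hx hrun₀, mem_lfpEnv_of_bsteps hWF hx (hrun n)]
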